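/- For every oracle B, the parameterized decision problem (L₂^B, ||) belongs to para-P^B, where L₂^B = { 1² 0 1^i x : i ≥ 1, x ∈ Σ*, and 1² 0 1^i x # 1u' ∈ B }, with y'_j = 1 0^{|x|−j} 1^j for j ∈ [|x|], u_j the membership bit B(1² 0 1^i x # 0 y'_j), and u' = u₁u₂⋯u_{|x|}. -/

import Mathlib

open scoped Classical

/-! ## A model of oracle Turing machines

A machine has a read-only input tape (with endmarkers), a rewritable work tape
(only its cells count toward space usage), and a write-only query tape.
When the machine enters its query state with word `w` on the query tape,
the query tape is erased and the state becomes `qyes` if `w` is in the oracle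
and `qno` otherwise. -/

/-- Head moves. -/
inductive TMove | left | right | stay

/-- Apply a head move to a (ℕ-indexed) head position. -/
def TMove.app : TMove → ℕ → ℕ
  | .left, n => n - 1
  | .right, n => n + 1
  | .stay, n => n

/-- Symbols readable on the input tape: the endmarkers or an alphabet symbol. -/
inductive ISym (Γ : Type) | lend | rend | sym (a : Γ)

/-- Reading the input tape `|c x $` at position `i`. -/
def inputRead {Γ : Type} (x : List Γ) (i : ℕ) : ISym Γ :=
  if i = 0 then ISym.lend
  else
    match x[i - 1]? with
    | some a => ISym.sym a
    | none => ISym.rend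

/-- Result of one transition: new state, symbol written to the work tape,
input-head and work-head moves, and an optional symbol appended to the
write-only query tape. -/
structure TMOut (Γ : Type) (k : ℕ) where
  st : Fin k
  wr : Option Γ
  mi : TMove
  mw : TMove
  qw : Option Γ

/-- Configuration of an oracle machine with `k` states: current state, input
head position, work tape content and head position, current query-tape content,
and the maximal work-tape cell visited so far (the space used). -/
structure OCfg (Γ : Type) (k : ℕ) where
  state : Fin k
  ipos : ℕ
  work : ℕ → Option Γ
  wpos : ℕ
  qtape : List Γ
  maxw : ℕ

/-- Apply the result of a transition to a configuration. -/
def applyOut {Γ : Type} {k : ℕ} (c : OCfg Γ k) (o : TMOut Γ k) : OCfg Γ k :=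
  let w' := o.mw.app c.wpos
  { state := o.st
    ipos := o.mi.app c.ipos
    work := Function.update c.work c.wpos o.wr
    wpos := w'
    qtape := c.qtape ++ o.qw.toList
    maxw := max c.maxw w' }

/-- Deterministic oracle Turing machine (states are `Fin k`). -/
structure OTM (Γ : Type) where
  k : ℕ
  q0 : Fin k
  qacc : Fin k
  qrej : Fin k
  qquery : Fin k
  qyes : Fin k
  qno : Fin k
  δ : Fin k → ISym Γ → Option Γ → TMOut Γ k

/-- Initial configuration. -/
def OTM.init {Γ : Type} (M : OTM Γ) : OCfg Γ M.k :=
  ⟨M.q0, 0, fun _ => none, 0, [], 0⟩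

/-- One deterministic step, relative to oracle `A`, on input `x`.
Halting configurations are fixed; in the query state the oracle answers and the
query tape is erased. -/
noncomputable def OTM.step {Γ : Type} (M : OTM Γ) (A : Set (List Γ)) (x : List Γ)
    (c : OCfg Γ M.k) : OCfg Γ M.k :=
  if c.state = M.qacc ∨ c.state = M.qrej then c
  else if c.state = M.qquery then
    { c with state := if c.qtape ∈ A then M.qyes else M.qno, qtape := ([] : List Γ) }
  else applyOut c (M.δ c.state (inputRead x c.ipos) (c.work c.wpos))

/-- The configuration after `t` steps on input `x` with oracle `A`. -/
noncomputable def OTM.cfgAt {Γ : Type} (M : OTM Γ) (A : Set (List Γ)) (x : List Γ)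
    (t : ℕ) : OCfg Γ M.k :=
  (M.step A x)^[t] M.init

/-- A configuration is halting if its state is accepting or rejecting. -/
def OTM.Halted {Γ : Type} (M : OTM Γ) (c : OCfg Γ M.k) : Prop :=
  c.state = M.qacc ∨ c.state = M.qrej

/-- `M` with oracle `A` recognizes `L`, halting within time `T` (no space bound). -/
def OTM.DecidesT {Γ : Type} (M : OTM Γ) (A L : Set (List Γ)) (T : List Γ → ℝ) : Prop :=
  ∀ x, ∃ t : ℕ, (t : ℝ) ≤ T x ∧ M.Halted (M.cfgAt A x t) ∧
    (x ∈ L ↔ (M.cfgAt A x t).state = M.qacc)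

/-- `M` with oracle `A` recognizes `L`, halting within time `T` and using work
space at most `S` (note `maxw` is monotone along a run, so the bound at the
halting time bounds the whole computation). -/
def OTM.DecidesTS {Γ : Type} (M : OTM Γ) (A L : Set (List Γ)) (T S : List Γ → ℝ) : Prop :=
  ∀ x, ∃ t : ℕ, (t : ℝ) ≤ T x ∧ M.Halted (M.cfgAt A x t) ∧
    ((M.cfgAt A x t).maxw : ℝ) ≤ S x ∧
    (x ∈ L ↔ (M.cfgAt A x t).state = M.qacc)

/-- `M` (run with the empty oracle, its write-only query tape serving as a
write-only output tape) outputs `f x` on every input `x`, using work space at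
most `S x`. -/
def OTM.Outputs {Γ : Type} (M : OTM Γ) (f : List Γ → List Γ) (S : List Γ → ℝ) : Prop :=
  ∀ x, ∃ t : ℕ, (M.cfgAt ∅ x t).state = M.qacc ∧
    ((M.cfgAt ∅ x t).maxw : ℝ) ≤ S x ∧ (M.cfgAt ∅ x t).qtape = f x

/-- A log-space size parameter: some deterministic Turing machine with a
write-only output tape outputs `1^{m x}` on input `x` using `O(log |x|)` work
space (`o1` is the symbol `1` of the alphabet). -/
def LogSpaceSizeParam {Γ : Type} (o1 : Γ) (m : List Γ → ℕ) : Prop :=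
  ∃ (M : OTM Γ) (c : ℕ), M.Outputs (fun x => List.replicate (m x) o1)
    (fun x => c * Real.logb 2 (x.length + 2) + c)

/-- Nondeterministic oracle Turing machine. -/
structure ONTM (Γ : Type) where
  k : ℕ
  q0 : Fin k
  qacc : Fin k
  qrej : Fin k
  qquery : Fin k
  qyes : Fin k
  qno : Fin k
  δ : Fin k → ISym Γ → Option Γ → Set (TMOut Γ k)

/-- Initial configuration. -/
def ONTM.init {Γ : Type} (M : ONTM Γ) : OCfg Γ M.k :=
  ⟨M.q0, 0, fun _ => none, 0, [], 0⟩

/-- A configuration is halting if its state is accepting or rejecting. -/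
def ONTM.Halted {Γ : Type} (M : ONTM Γ) (c : OCfg Γ M.k) : Prop :=
  c.state = M.qacc ∨ c.state = M.qrej

/-- One nondeterministic step, relative to oracle `A`, on input `x`. -/
def ONTM.Step {Γ : Type} (M : ONTM Γ) (A : Set (List Γ)) (x : List Γ)
    (c c' : OCfg Γ M.k) : Prop :=
  (M.Halted c ∧ c' = c) ∨
  (¬ M.Halted c ∧ c.state = M.qquery ∧
    ((c.qtape ∈ A ∧ c' = { c with state := M.qyes, qtape := ([] : List Γ) }) ∨
     (c.qtape ∉ A ∧ c' = { c with state := M.qno, qtape := ([] : List Γ) }))) ∨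
  (¬ M.Halted c ∧ c.state ≠ M.qquery ∧
    ∃ o ∈ M.δ c.state (inputRead x c.ipos) (c.work c.wpos), c' = applyOut c o)

/-- A (computation path) run of `M` on `x` with oracle `A`. -/
def ONTM.IsRun {Γ : Type} (M : ONTM Γ) (A : Set (List Γ)) (x : List Γ)
    (r : ℕ → OCfg Γ M.k) : Prop :=
  r 0 = M.init ∧ ∀ t, M.Step A x (r t) (r (t + 1))

/-- `M` with oracle `A` recognizes `L` nondeterministically: every computation
path halts within time `T` and uses work space at most `S`, and `x ∈ L` iff
some computation path accepts. -/
def ONTM.DecidesTS {Γ : Type} (M : ONTM Γ) (A L : Set (List Γ)) (T S : List Γ → ℝ) : Prop :=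
  ∀ x,
    (∀ r, M.IsRun A x r → ∃ t : ℕ, (t : ℝ) ≤ T x ∧ M.Halted (r t)) ∧
    (∀ r, M.IsRun A x r → ∀ t : ℕ, (t : ℝ) ≤ T x → ((r t).maxw : ℝ) ≤ S x) ∧
    (x ∈ L ↔ ∃ r, M.IsRun A x r ∧ ∃ t : ℕ, (t : ℝ) ≤ T x ∧ (r t).state = M.qacc)

/-! ## Parameterized complexity classes relative to an oracle -/

/-- A parameterized decision problem: a language together with a size parameter. -/
abbrev ParaProblem (Γ : Type) := Set (List Γ) × (List Γ → ℕ)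

/-- The polynomial time bound `(|x| · m(x))^{O(1)}`. -/
def polyB {Γ : Type} (m : List Γ → ℕ) (c : ℕ) : List Γ → ℝ :=
  fun x => ((x.length * m x + 2 : ℕ) : ℝ) ^ c

/-- The logarithmic space bound `O(log (|x| · m(x)))`. -/
noncomputable def logB {Γ : Type} (m : List Γ → ℕ) (c : ℕ) : List Γ → ℝ :=
  fun x => c * Real.logb 2 (x.length * m x + 2) + c

/-- `para-L^A`: deterministic, polynomial time, logarithmic space. -/
def paraL {Γ : Type} (o1 : Γ) (A : Set (List Γ)) : Set (ParaProblem Γ) :=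
  { P | LogSpaceSizeParam o1 P.2 ∧
      ∃ (M : OTM Γ) (c : ℕ), M.DecidesTS A P.1 (polyB P.2 c) (logB P.2 c) }

/-- `para-NL^A`: nondeterministic, polynomial time, logarithmic space. -/
def paraNL {Γ : Type} (o1 : Γ) (A : Set (List Γ)) : Set (ParaProblem Γ) :=
  { P | LogSpaceSizeParam o1 P.2 ∧
      ∃ (M : ONTM Γ) (c : ℕ), M.DecidesTS A P.1 (polyB P.2 c) (logB P.2 c) }

/-- `para-P^A`: deterministic, polynomial time. -/
def paraP {Γ : Type} (o1 : Γ) (A : Set (List Γ)) : Set (ParaProblem Γ) :=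
  { P | LogSpaceSizeParam o1 P.2 ∧
      ∃ (M : OTM Γ) (c : ℕ), M.DecidesT A P.1 (polyB P.2 c) }

/-- `PsubLIN^A`: deterministic, polynomial time, sub-linear space
`O(m(x)^ε · log^k |x|)` for some `ε ∈ [0,1)` and `k ∈ ℕ`. -/
def PsubLIN {Γ : Type} (o1 : Γ) (A : Set (List Γ)) : Set (ParaProblem Γ) :=
  { P | LogSpaceSizeParam o1 P.2 ∧
      ∃ (M : OTM Γ) (c k : ℕ) (ε : ℝ), 0 ≤ ε ∧ ε < 1 ∧
        M.DecidesTS A P.1 (polyB P.2 c)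
          (fun x => c * (P.2 x : ℝ) ^ ε * Real.logb 2 (x.length + 2) ^ k + c) }

/-- `para-LOG²SPACE^A`: deterministic, time `|x|^{log|x|} · m(x)^{log m(x)}`,
space `O(log²|x| + log² m(x))`. -/
def paraLOG2 {Γ : Type} (o1 : Γ) (A : Set (List Γ)) : Set (ParaProblem Γ) :=
  { P | LogSpaceSizeParam o1 P.2 ∧
      ∃ (M : OTM Γ) (c : ℕ),
        M.DecidesTS A P.1
          (fun x => c * ((x.length + 2 : ℝ) ^ Real.logb 2 (x.length + 2)) *
              ((P.2 x + 2 : ℝ) ^ Real.logb 2 (P.2 x + 2)) + c)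
          (fun x => c * Real.logb 2 (x.length + 2) ^ 2 +
              c * Real.logb 2 (P.2 x + 2) ^ 2 + c) }

/-- `co-para-NL^A`: all `(L, m)` such that `(Σ* − L, m) ∈ para-NL^A`. -/
def coParaNL {Γ : Type} (o1 : Γ) (A : Set (List Γ)) : Set (ParaProblem Γ) :=
  { P | (P.1ᶜ, P.2) ∈ paraNL o1 A }

/-- An oracle `A` is NL-supportive if (1) `para-L^A ⊆ para-NL^A ⊆ para-P^A`,
(2) `para-NL^A = co-para-NL^A`, and (3) `para-NL^A ⊆ para-LOG²SPACE^A`. -/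
def NLSupportive {Γ : Type} (o1 : Γ) (A : Set (List Γ)) : Prop :=
  (paraL o1 A ⊆ paraNL o1 A ∧ paraNL o1 A ⊆ paraP o1 A) ∧
  paraNL o1 A = coParaNL o1 A ∧
  paraNL o1 A ⊆ paraLOG2 o1 A

/-- A recursive oracle: membership is decidable by a computable function. -/
def RecursiveOracle (A : Set (List Bool)) : Prop :=
  ∃ f : List Bool → Bool, Computable f ∧ ∀ w, w ∈ A ↔ f w = true

/-- Embedding of binary strings into strings over `{0, 1, #}`
(`# = (2 : Fin 3)`). -/
def emb (x : List Bool) : List (Fin 3) := x.map (fun b => if b then 1 else 0)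

/-- The string `1² 0 1^i x`. -/
def word2 (i : ℕ) (x : List Bool) : List (Fin 3) :=
  1 :: 1 :: 0 :: (List.replicate i 1 ++ emb x)

/-- `y'_j = 1 0^{|x| − j} 1^j`. -/
def ybit' (x : List Bool) (j : ℕ) : List (Fin 3) :=
  1 :: (List.replicate (x.length - j) 0 ++ List.replicate j 1)

/-- `u' = u₁u₂⋯u_{|x|}` where `u_j = B(1² 0 1^i x # 0 y'_j)`. -/
noncomputable def ubits' (B : Set (List (Fin 3))) (i : ℕ) (x : List Bool) :
    List (Fin 3) :=
  (List.range x.length).map (fun j =>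
    if word2 i x ++ 2 :: 0 :: ybit' x (j + 1) ∈ B then 1 else 0)

/-- `L₂^B = { 1² 0 1^i x : i ≥ 1, x ∈ Σ*, 1² 0 1^i x # 1u' ∈ B }`. -/
def L2 (B : Set (List (Fin 3))) : Set (List (Fin 3)) :=
  { w | ∃ i : ℕ, 1 ≤ i ∧ ∃ x : List Bool, w = word2 i x ∧
      word2 i x ++ 2 :: 1 :: ubits' B i x ∈ B }

/-! ## The size parameter `|x|` is log-space -/

/-- The machine that copies its input as a string of `1`s, using no work tape. -/
noncomputable def unaryLength : OTM (Fin 3) where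
  k := 3
  q0 := 0
  qacc := 1
  qrej := 2
  qquery := 2
  qyes := 2
  qno := 2
  δ := fun _ i c => match i with
    | .lend => ⟨0, c, .right, .stay, none⟩
    | .sym _ => ⟨0, c, .right, .stay, some 1⟩
    | .rend => ⟨1, c, .stay, .stay, none⟩

theorem inputRead_zero {Γ : Type} (w : List Γ) : inputRead w 0 = .lend := rfl

theorem inputRead_succ {Γ : Type} (w : List Γ) (p : ℕ) (h : p < w.length) :
    inputRead w (p + 1) = .sym w[p] := by
  simp [inputRead, h]

theorem inputRead_of_length_lt {Γ : Type} (w : List Γ) (p : ℕ) (h : w.length < p) :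
    inputRead w p = .rend := by
  have h0 : p ≠ 0 := by omega
  have h1 : w[p - 1]? = none := by simp; omega
  simp [inputRead, h0, h1]

theorem inputRead_ne_lend {Γ : Type} (w : List Γ) (p : ℕ) (h : 0 < p) :
    inputRead w p ≠ .lend := by
  unfold inputRead
  rw [if_neg (by omega)]
  split <;> simp

theorem inputRead_ne_rend {Γ : Type} (w : List Γ) (p : ℕ) (h : p ≤ w.length) :
    inputRead w p ≠ .rend := by
  rcases p with _ | p
  · simp [inputRead]
  · simp [inputRead_succ w p (by omega)]

theorem unaryLength_cfgAt (w : List (Fin 3)) (p : ℕ) (h : p ≤ w.length) :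
    unaryLength.cfgAt ∅ w (p + 1) =
      ⟨(0 : Fin 3), p + 1, fun _ => none, 0, List.replicate p 1, 0⟩ := by
  induction p with
  | zero =>
    simp [OTM.cfgAt, OTM.init, OTM.step, unaryLength, applyOut, inputRead_zero, TMove.app]
  | succ p ih =>
    have ih := ih (by omega)
    unfold OTM.cfgAt at ih ⊢
    rw [Function.iterate_succ_apply', ih]
    simp [OTM.step, unaryLength, applyOut, inputRead_succ w p (by omega), TMove.app,
      List.replicate_succ']

theorem logSpaceSizeParam_length :
    LogSpaceSizeParam (1 : Fin 3) (fun w : List (Fin 3) => w.length) := by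
  refine ⟨unaryLength, 0, fun w => ⟨w.length + 2, ?_⟩⟩
  have h : unaryLength.cfgAt ∅ w (w.length + 2) =
      ⟨(1 : Fin 3), w.length + 1, fun _ => none, 0, List.replicate w.length 1, 0⟩ := by
    have h := unaryLength_cfgAt w w.length le_rfl
    unfold OTM.cfgAt at h ⊢
    rw [Function.iterate_succ_apply', h]
    simp [OTM.step, unaryLength, applyOut, inputRead_of_length_lt w (w.length + 1) (by omega),
      TMove.app]
  rw [h]
  exact ⟨rfl, by simp, rfl⟩

/-! ## Machines whose input and work heads move together -/

/-- The states of the machine deciding `L2 B`. -/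
inductive St
  | start | pre1 | pre2 | pre3 | fill | back | next | reset | rew | copy | check | one
  | unary | toAsk | toStart | emit | ask | answer (b : Bool) | put (b : Bool) | acc | rej
  deriving Fintype

/-- The result of one transition of a machine whose two heads move together. -/
structure Act where
  st : St
  wr : Option (Fin 3)
  mv : TMove
  em : Option (Fin 3)

/-- The symbol of a bit. -/
def bitSym (b : Bool) : Fin 3 := if b then 1 else 0

/-- The transition function of the machine deciding `L2 B`. -/
noncomputable def act (s : St) (i : ISym (Fin 3)) (c : Option (Fin 3)) : Act :=
  match s with
  | .start => ⟨.pre1, c, .right, none⟩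
  | .pre1 => if i = .sym 1 then ⟨.pre2, c, .right, none⟩ else ⟨.rej, c, .stay, none⟩
  | .pre2 => if i = .sym 1 then ⟨.pre3, c, .right, none⟩ else ⟨.rej, c, .stay, none⟩
  | .pre3 => if i = .sym 0 then ⟨.fill, c, .right, none⟩ else ⟨.rej, c, .stay, none⟩
  | .fill => if i = .rend then ⟨.back, c, .left, none⟩
      else if i = .sym 2 then ⟨.rej, c, .stay, none⟩ else ⟨.fill, some 2, .right, none⟩
  | .back => if i = .lend then ⟨.next, c, .right, none⟩ else ⟨.back, c, .left, none⟩
  | .next => if i = .rend then ⟨.rej, c, .stay, none⟩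
      else if c = none then ⟨.next, c, .right, none⟩
      else if i = .sym 1 then ⟨.reset, none, .right, none⟩ else ⟨.rej, c, .stay, none⟩
  | .reset => if i = .rend then ⟨.rew, c, .left, none⟩ else ⟨.reset, some 2, .right, none⟩
  | .rew => if i = .lend then ⟨.copy, c, .right, none⟩ else ⟨.rew, c, .left, none⟩
  | .copy => match i with
      | .sym a => ⟨.copy, c, .right, some a⟩
      | _ => ⟨.check, c, .left, some 2⟩
  | .check => if c = some 2 then ⟨.one, c, .stay, some 0⟩ else ⟨.toStart, c, .left, some 1⟩
  | .one => ⟨.unary, c, .left, some 1⟩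
  | .unary => if c = none then ⟨.toAsk, c, .left, some 1⟩
      else if c = some 2 then ⟨.unary, c, .left, some 0⟩ else ⟨.unary, c, .left, some 1⟩
  | .toAsk => if i = .lend then ⟨.ask, c, .stay, none⟩ else ⟨.toAsk, c, .left, none⟩
  | .toStart => if i = .lend then ⟨.emit, c, .right, none⟩ else ⟨.toStart, c, .left, none⟩
  | .emit => if i = .rend then ⟨.ask, c, .stay, none⟩ else ⟨.emit, c, .right, c⟩
  | .answer b => if i = .lend then ⟨.put b, c, .right, none⟩
      else if b then ⟨.acc, c, .stay, none⟩ else ⟨.back, c, .left, none⟩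
  | .put b => if c = some 2 then ⟨.rew, some (bitSym b), .left, none⟩
      else ⟨.put b, c, .right, none⟩
  | .ask => ⟨.rej, c, .stay, none⟩
  | .acc => ⟨.acc, c, .stay, none⟩
  | .rej => ⟨.rej, c, .stay, none⟩

/-- Configurations of a machine whose two heads are at the same position. -/
structure HCfg where
  st : St
  pos : ℕ
  work : ℕ → Option (Fin 3)
  q : List (Fin 3)

/-- One step on configurations with a common head position. -/
noncomputable def hstep (B : Set (List (Fin 3))) (w : List (Fin 3)) (h : HCfg) : HCfg :=
  if h.st = .acc ∨ h.st = .rej then h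
  else if h.st = .ask then ⟨.answer (decide (h.q ∈ B)), h.pos, h.work, []⟩
  else
    let o := act h.st (inputRead w h.pos) (h.work h.pos)
    ⟨o.st, o.mv.app h.pos, Function.update h.work h.pos o.wr, h.q ++ o.em.toList⟩

/-- The numbering of the states. -/
noncomputable def stEquiv : St ≃ Fin (Fintype.card St) := Fintype.equivFin St

/-- The oracle machine deciding `L2 B`. -/
noncomputable def machine : OTM (Fin 3) where
  k := Fintype.card St
  q0 := stEquiv .start
  qacc := stEquiv .acc
  qrej := stEquiv .rej
  qquery := stEquiv .ask
  qyes := stEquiv (.answer true)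
  qno := stEquiv (.answer false)
  δ := fun s i c =>
    let o := act (stEquiv.symm s) i c
    ⟨stEquiv o.st, o.wr, o.mv, o.mv, o.em⟩

/-- The machine configuration given by a configuration with a common head position and
an amount of space used. -/
noncomputable def HCfg.toOCfg (h : HCfg) (mx : ℕ) : OCfg (Fin 3) machine.k :=
  ⟨stEquiv h.st, h.pos, h.work, h.pos, h.q, mx⟩

theorem machine_step (B : Set (List (Fin 3))) (w : List (Fin 3)) (h : HCfg) (mx : ℕ) :
    ∃ mx', machine.step B w (h.toOCfg mx) = (hstep B w h).toOCfg mx' := by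
  unfold OTM.step hstep
  have e (s t : St) : stEquiv s = stEquiv t ↔ s = t := stEquiv.injective.eq_iff
  have h1 : (h.toOCfg mx).state = machine.qacc ↔ h.st = .acc := e _ _
  have h2 : (h.toOCfg mx).state = machine.qrej ↔ h.st = .rej := e _ _
  have h3 : (h.toOCfg mx).state = machine.qquery ↔ h.st = .ask := e _ _
  simp only [h1, h2, h3]
  by_cases a : h.st = .acc ∨ h.st = .rej
  · rw [if_pos a, if_pos a]
    exact ⟨mx, rfl⟩
  rw [if_neg a, if_neg a]
  by_cases b : h.st = .ask
  · rw [if_pos b, if_pos b]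
    refine ⟨mx, ?_⟩
    by_cases hq : h.q ∈ B <;> simp [HCfg.toOCfg, machine, hq]
  · rw [if_neg b, if_neg b]
    refine ⟨max mx ((act h.st (inputRead w h.pos) (h.work h.pos)).mv.app h.pos), ?_⟩
    simp [HCfg.toOCfg, machine, applyOut]

theorem machine_cfgAt (B : Set (List (Fin 3))) (w : List (Fin 3)) (t : ℕ) :
    ∃ mx, machine.cfgAt B w t =
      ((hstep B w)^[t] ⟨.start, 0, fun _ => none, []⟩).toOCfg mx := by
  induction t with
  | zero => exact ⟨0, rfl⟩
  | succ t ih =>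
    obtain ⟨mx, h⟩ := ih
    unfold OTM.cfgAt at h ⊢
    rw [Function.iterate_succ_apply', Function.iterate_succ_apply', h]
    exact machine_step B w _ mx

/-- `h'` is reached from `h` within `k` steps. -/
def Reach (B : Set (List (Fin 3))) (w : List (Fin 3)) (k : ℕ) (h h' : HCfg) : Prop :=
  ∃ t ≤ k, (hstep B w)^[t] h = h'

section Runs

variable {B : Set (List (Fin 3))} {w : List (Fin 3)}

theorem Reach.trans {k l : ℕ} {a b c : HCfg} (h : Reach B w k a b) (h' : Reach B w l b c) :
    Reach B w (k + l) a c := by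
  obtain ⟨s, hs, rfl⟩ := h
  obtain ⟨t, ht, rfl⟩ := h'
  exact ⟨t + s, by omega, Function.iterate_add_apply _ _ _ _⟩

theorem Reach.mono {k l : ℕ} {a b : HCfg} (h : Reach B w k a b) (hkl : k ≤ l) :
    Reach B w l a b := by
  obtain ⟨s, hs, h⟩ := h
  exact ⟨s, by omega, h⟩

theorem Reach.single {a b : HCfg} (h : hstep B w a = b) : Reach B w 1 a b :=
  ⟨1, le_rfl, h⟩

theorem Reach.family (C : ℕ → HCfg) (k : ℕ) (h : ∀ r < k, hstep B w (C r) = C (r + 1)) :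
    Reach B w k (C 0) (C k) := by
  refine ⟨k, le_rfl, ?_⟩
  induction k with
  | zero => rfl
  | succ k ih =>
    rw [Function.iterate_succ_apply', ih fun r hr => h r (by omega), h k (by omega)]

/-- A state that moves to the left endmarker. -/
def LeftSweep (s : St) : Prop :=
  s ≠ .acc ∧ s ≠ .rej ∧ s ≠ .ask ∧ ∀ i c, i ≠ .lend → act s i c = ⟨s, c, .left, none⟩

theorem leftSweep_reach {s : St} (hs : LeftSweep s) (p : ℕ) (W : ℕ → Option (Fin 3))
    (q : List (Fin 3)) : Reach B w p ⟨s, p, W, q⟩ ⟨s, 0, W, q⟩ := by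
  have := Reach.family (B := B) (w := w) (fun r => ⟨s, p - r, W, q⟩) p fun r hr => by
    obtain ⟨h1, h2, h3, h4⟩ := hs
    simp [hstep, h1, h2, h3, h4 _ _ (inputRead_ne_lend w (p - r) (by omega)), TMove.app]
    omega
  simpa using this

theorem leftSweep_back : LeftSweep .back := by
  refine ⟨by simp, by simp, by simp, fun i c h => by simp [act, h]⟩

theorem leftSweep_rew : LeftSweep .rew := by
  refine ⟨by simp, by simp, by simp, fun i c h => by simp [act, h]⟩

theorem leftSweep_toAsk : LeftSweep .toAsk := by
  refine ⟨by simp, by simp, by simp, fun i c h => by simp [act, h]⟩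

theorem leftSweep_toStart : LeftSweep .toStart := by
  refine ⟨by simp, by simp, by simp, fun i c h => by simp [act, h]⟩

/-! ## The work tape -/

/-- The work tape with blank cells up to `a`, followed by the symbols of `u`, and
by the symbol `2` up to cell `n`. -/
def tape (a n : ℕ) (u : List (Fin 3)) (p : ℕ) : Option (Fin 3) :=
  if p ≤ a ∨ n < p then none else some (u[p - a - 1]?.getD 2)

theorem tape_of_le {a n p : ℕ} {u : List (Fin 3)} (h : p ≤ a) : tape a n u p = none := by
  simp [tape, h]

theorem tape_bit {a n j : ℕ} {u : List (Fin 3)} (h : j < u.length) (hn : a + j + 1 ≤ n) :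
    tape a n u (a + j + 1) = some u[j] := by
  have h2 : a + j + 1 - a - 1 = j := by omega
  simp [tape, h2, h, show a + j < n by omega]

theorem tape_two {a n p : ℕ} {u : List (Fin 3)} (h : a + u.length < p) (hn : p ≤ n) :
    tape a n u p = some 2 := by
  have h1 : ¬ (p ≤ a ∨ n < p) := by omega
  have h2 : u[p - a - 1]? = none := by simp; omega
  simp [tape, h1, h2]

theorem update_tape {a n : ℕ} {u : List (Fin 3)} (b : Fin 3) (h : a + u.length + 1 ≤ n) :
    Function.update (tape a n u) (a + u.length + 1) (some b) = tape a n (u ++ [b]) := by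
  funext p
  by_cases hp : p = a + u.length + 1
  · subst hp
    have h2 : a + u.length + 1 - a - 1 = u.length := by omega
    simp [tape, h2, show a + u.length < n by omega]
  · rw [Function.update_of_ne hp]
    unfold tape
    split_ifs with h1
    · rfl
    · rcases lt_or_ge (p - a - 1) u.length with h2 | h2
      · rw [List.getElem?_append_left h2]
      · rw [List.getElem?_eq_none h2, List.getElem?_eq_none (by simp; omega)]

/-! ## The phases of a run -/

theorem copy_reach (W : ℕ → Option (Fin 3)) :
    Reach B w (w.length + 1) ⟨.copy, 1, W, []⟩ ⟨.check, w.length, W, w ++ [2]⟩ := by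
  have h1 := Reach.family (B := B) (w := w) (fun r => ⟨.copy, r + 1, W, w.take r⟩)
    w.length fun r hr => by
      simp [hstep, act, inputRead_succ w r hr, TMove.app]
  refine Reach.trans (by simpa using h1) (Reach.single ?_)
  simp [hstep, act, inputRead_of_length_lt w (w.length + 1) (by omega), TMove.app]

theorem rew_reach (p : ℕ) (W : ℕ → Option (Fin 3)) :
    Reach B w (p + 1) ⟨.rew, p, W, []⟩ ⟨.copy, 1, W, []⟩ :=
  (leftSweep_reach leftSweep_rew p W []).trans <| Reach.single <| by
    simp [hstep, act, inputRead_zero, TMove.app]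

theorem unary_reach {a : ℕ} {u : List (Fin 3)} (hu : ∀ b ∈ u, b ≠ 2)
    (ha : 0 < a) (h : a + u.length + 1 ≤ w.length) (q : List (Fin 3)) :
    Reach B w (w.length + 1) ⟨.unary, w.length - 1, tape a w.length u, q⟩
      ⟨.ask, 0, tape a w.length u, q ++ (List.replicate (w.length - a - (u.length + 1)) 0 ++
        List.replicate (u.length + 1) 1)⟩ := by
  have h1 := Reach.family (B := B) (w := w)
    (fun r => ⟨.unary, w.length - 1 - r, tape a w.length u, q ++ List.replicate r 0⟩)
    (w.length - a - (u.length + 1)) fun r hr => by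
      simp [hstep, act, tape_two (u := u) (a := a) (p := w.length - 1 - r) (n := w.length)
        (by omega) (by omega), TMove.app, List.replicate_succ']
      omega
  have e1 : w.length - 1 - (w.length - a - (u.length + 1)) = a + u.length := by omega
  have h2 := Reach.family (B := B) (w := w)
    (fun r => ⟨.unary, a + u.length - r, tape a w.length u,
      q ++ List.replicate (w.length - a - (u.length + 1)) 0 ++ List.replicate r 1⟩)
    u.length fun r hr => by
      have e : a + u.length - r = a + (u.length - r - 1) + 1 := by omega
      have e' : a + u.length - (r + 1) = a + (u.length - r - 1) := by omega
      have hb : u[u.length - r - 1] ≠ 2 := hu _ (List.getElem_mem _)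
      have ht := tape_bit (a := a) (n := w.length) (u := u) (j := u.length - r - 1)
        (by omega) (by omega)
      simp only [e, e']
      simp [hstep, act, ht, hb, TMove.app, List.replicate_succ']
  have h3 : hstep B w ⟨.unary, a, tape a w.length u,
      q ++ List.replicate (w.length - a - (u.length + 1)) 0 ++ List.replicate u.length 1⟩ =
      ⟨.toAsk, a - 1, tape a w.length u,
      q ++ List.replicate (w.length - a - (u.length + 1)) 0 ++
        List.replicate (u.length + 1) 1⟩ := by
    have ht : tape a w.length u a = none := tape_of_le le_rfl
    simp [hstep, act, ht, TMove.app, List.replicate_succ']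
  simp only [Nat.sub_zero, List.replicate_zero, List.append_nil, e1, Nat.add_sub_cancel] at h1 h2
  have h4 := leftSweep_reach (B := B) (w := w) leftSweep_toAsk (a - 1) (tape a w.length u)
    (q ++ List.replicate (w.length - a - (u.length + 1)) 0 ++ List.replicate (u.length + 1) 1)
  have h5 : hstep B w ⟨.toAsk, 0, tape a w.length u,
      q ++ List.replicate (w.length - a - (u.length + 1)) 0 ++
        List.replicate (u.length + 1) 1⟩ = ⟨.ask, 0, tape a w.length u,
      q ++ List.replicate (w.length - a - (u.length + 1)) 0 ++
        List.replicate (u.length + 1) 1⟩ := by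
    simp [hstep, act, inputRead_zero, TMove.app]
  rw [← List.append_assoc]
  exact ((((h1.trans h2).trans (Reach.single h3)).trans h4).trans (Reach.single h5)).mono
    (by omega)

theorem put_reach {a : ℕ} {u : List (Fin 3)} (hu : ∀ b ∈ u, b ≠ 2)
    (h : a + u.length + 1 ≤ w.length) (b : Bool) :
    Reach B w (w.length + 1) ⟨.put b, 1, tape a w.length u, []⟩
      ⟨.rew, a + u.length, tape a w.length (u ++ [bitSym b]), []⟩ := by
  have h1 := Reach.family (B := B) (w := w)
    (fun r => ⟨.put b, r + 1, tape a w.length u, []⟩) (a + u.length) fun r hr => by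
      have ht : tape a w.length u (r + 1) ≠ some 2 := by
        rcases le_or_gt (r + 1) a with hr' | hr'
        · simp [tape_of_le hr']
        · obtain ⟨j, rfl⟩ : ∃ j, r = a + j := ⟨r - a, by omega⟩
          rw [tape_bit (by omega) (by omega)]
          simpa using hu _ (List.getElem_mem _)
      simp [hstep, act, ht, TMove.app]
  refine (h1.trans (Reach.single (b := ⟨.rew, a + u.length,
    tape a w.length (u ++ [bitSym b]), []⟩) ?_)).mono (by omega)
  simp [hstep, act, tape_two (a := a) (u := u) (p := a + u.length + 1) (by omega) h,
    TMove.app, update_tape _ h]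

/-- Computing one more bit of `u'`. -/
theorem bit_reach {a : ℕ} {u : List (Fin 3)} (hu : ∀ b ∈ u, b ≠ 2)
    (ha : 0 < a) (h : a + u.length + 1 ≤ w.length) :
    Reach B w (4 * w.length + 8) ⟨.copy, 1, tape a w.length u, []⟩
      ⟨.copy, 1, tape a w.length (u ++ [if w ++ 2 :: 0 :: 1 ::
        (List.replicate (w.length - a - (u.length + 1)) 0 ++
          List.replicate (u.length + 1) 1) ∈ B then 1 else 0]), []⟩ := by
  have ht := tape_two (a := a) (u := u) (p := w.length) (n := w.length) (by omega) le_rfl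
  have h1 := copy_reach (B := B) (w := w) (tape a w.length u)
  have h2 : hstep B w ⟨.check, w.length, tape a w.length u, w ++ [2]⟩ =
      ⟨.one, w.length, tape a w.length u, w ++ [2, 0]⟩ := by
    simp [hstep, act, ht, TMove.app]
  have h3 : hstep B w ⟨.one, w.length, tape a w.length u, w ++ [2, 0]⟩ =
      ⟨.unary, w.length - 1, tape a w.length u, w ++ [2, 0, 1]⟩ := by
    simp [hstep, act, TMove.app]
  have h4 := unary_reach (B := B) hu ha h (w ++ [2, 0, 1])
  have e : w ++ [2, 0, 1] ++ (List.replicate (w.length - a - (u.length + 1)) 0 ++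
      List.replicate (u.length + 1) 1) = w ++ 2 :: 0 :: 1 ::
        (List.replicate (w.length - a - (u.length + 1)) 0 ++
          List.replicate (u.length + 1) 1) := by simp
  rw [e] at h4
  generalize w ++ 2 :: 0 :: 1 :: (List.replicate (w.length - a - (u.length + 1)) 0 ++
          List.replicate (u.length + 1) 1) = z at h4 ⊢
  have h5 : hstep B w ⟨.ask, 0, tape a w.length u, z⟩ =
      ⟨.answer (decide (z ∈ B)), 0, tape a w.length u, []⟩ := by
    simp [hstep]
  have h6 : hstep B w ⟨.answer (decide (z ∈ B)), 0, tape a w.length u, []⟩ =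
      ⟨.put (decide (z ∈ B)), 1, tape a w.length u, []⟩ := by
    simp [hstep, act, inputRead_zero, TMove.app]
  have h7 := put_reach (B := B) hu h (decide (z ∈ B))
  have h8 := rew_reach (B := B) (w := w) (a + u.length)
    (tape a w.length (u ++ [bitSym (decide (z ∈ B))]))
  have e' : bitSym (decide (z ∈ B)) = if z ∈ B then 1 else 0 := by simp [bitSym]
  rw [e'] at h7 h8
  exact (((((((h1.trans (.single h2)).trans (.single h3)).trans h4).trans (.single h5)).trans
    (.single h6)).trans h7).trans h8).mono (by omega)

/-- Asking the final query, for a complete string `u'`. -/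
theorem final_reach {a : ℕ} {u : List (Fin 3)} (hu : ∀ b ∈ u, b ≠ 2)
    (h : a + u.length = w.length) :
    Reach B w (3 * w.length + 6) ⟨.copy, 1, tape a w.length u, []⟩
      ⟨.answer (decide (w ++ 2 :: 1 :: u ∈ B)), w.length + 1, tape a w.length u, []⟩ := by
  have h1 := copy_reach (B := B) (w := w) (tape a w.length u)
  have h2 : hstep B w ⟨.check, w.length, tape a w.length u, w ++ [2]⟩ =
      ⟨.toStart, w.length - 1, tape a w.length u, w ++ [2, 1]⟩ := by
    have ht : tape a w.length u w.length ≠ some 2 := by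
      rcases Nat.eq_zero_or_pos u.length with h0 | h0
      · simp [tape_of_le (show w.length ≤ a by omega)]
      · have e : w.length = a + (u.length - 1) + 1 := by omega
        have := tape_bit (a := a) (u := u) (j := u.length - 1) (n := w.length)
          (by omega) (by omega)
        rw [← e] at this
        rw [this]
        simpa using hu _ (List.getElem_mem _)
    simp [hstep, act, ht, TMove.app]
  have h3 := leftSweep_reach (B := B) (w := w) leftSweep_toStart (w.length - 1)
    (tape a w.length u) (w ++ [2, 1])
  have h4 : hstep B w ⟨.toStart, 0, tape a w.length u, w ++ [2, 1]⟩ =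
      ⟨.emit, 1, tape a w.length u, w ++ [2, 1]⟩ := by
    simp [hstep, act, inputRead_zero, TMove.app]
  have h5 := Reach.family (B := B) (w := w)
    (fun r => ⟨.emit, r + 1, tape a w.length u, w ++ [2, 1]⟩) a fun r hr => by
      simp [hstep, act, inputRead_ne_rend w (r + 1) (by omega), TMove.app,
        tape_of_le (show r + 1 ≤ a by omega)]
  have h6 := Reach.family (B := B) (w := w)
    (fun r => ⟨.emit, a + r + 1, tape a w.length u, w ++ [2, 1] ++ u.take r⟩) u.length
    fun r hr => by
      have ht := tape_bit (a := a) (u := u) (j := r) (n := w.length) hr (by omega)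
      simp [hstep, act, inputRead_ne_rend w (a + r + 1) (by omega), TMove.app, ht]
      omega
  have h7 : hstep B w ⟨.emit, w.length + 1, tape a w.length u, w ++ 2 :: 1 :: u⟩ =
      ⟨.ask, w.length + 1, tape a w.length u, w ++ 2 :: 1 :: u⟩ := by
    simp [hstep, act, inputRead_of_length_lt w (w.length + 1) (by omega), TMove.app]
  have h8 : hstep B w ⟨.ask, w.length + 1, tape a w.length u, w ++ 2 :: 1 :: u⟩ =
      ⟨.answer (decide (w ++ 2 :: 1 :: u ∈ B)), w.length + 1, tape a w.length u, []⟩ := by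
    simp [hstep]
  simp only [Nat.zero_add, Nat.add_zero, List.take_zero, List.append_nil, List.take_length, h,
    List.append_assoc, List.cons_append, List.nil_append] at h5 h6
  exact (((((((h1.trans (.single h2)).trans h3).trans (.single h4)).trans h5).trans h6).trans
    (.single h7)).trans (.single h8)).mono (by omega)

/-- Moving to the first cell that is not blank, in order to blank it. -/
theorem next_reach {a : ℕ} (p : ℕ) (u : List (Fin 3)) (ha : a ≤ w.length) :
    Reach B w (p + a + 1) ⟨.back, p, tape a w.length u, []⟩
      ⟨.next, a + 1, tape a w.length u, []⟩ := by
  have h1 := leftSweep_reach (B := B) (w := w) leftSweep_back p (tape a w.length u) []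
  have h2 : hstep B w ⟨.back, 0, tape a w.length u, []⟩ =
      ⟨.next, 1, tape a w.length u, []⟩ := by
    simp [hstep, act, inputRead_zero, TMove.app]
  have h3 := Reach.family (B := B) (w := w)
    (fun r => ⟨.next, r + 1, tape a w.length u, []⟩) a fun r hr => by
      simp [hstep, act, inputRead_ne_rend w (r + 1) (by omega), TMove.app,
        tape_of_le (show r + 1 ≤ a by omega)]
  exact ((h1.trans (.single h2)).trans h3).mono (by omega)

theorem next_reject {a : ℕ} (p : ℕ) (u : List (Fin 3)) (ha : a ≤ w.length)
    (h : w[a]? ≠ some 1) :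
    ∃ c : HCfg, c.st = .rej ∧ Reach B w (p + a + 2) ⟨.back, p, tape a w.length u, []⟩ c := by
  refine ⟨_, ?_, (next_reach p u ha).trans (.single rfl)⟩
  rcases Nat.lt_or_ge a w.length with ha' | ha'
  · have h1 : tape a w.length u (a + 1) ≠ none := by
      simp [tape, ha']
    have h2 : ¬ w[a] = 1 := by simpa [ha'] using h
    simp [hstep, act, inputRead_succ w a ha', h1, h2]
  · simp [hstep, act, inputRead_of_length_lt w (a + 1) (by omega)]

theorem next_continue {a : ℕ} (p : ℕ) (u : List (Fin 3)) (h : w[a]? = some 1) :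
    Reach B w (p + 2 * w.length + 4) ⟨.back, p, tape a w.length u, []⟩
      ⟨.copy, 1, tape (a + 1) w.length [], []⟩ := by
  obtain ⟨ha, h1⟩ := List.getElem?_eq_some_iff.1 h
  have h2 : hstep B w ⟨.next, a + 1, tape a w.length u, []⟩ =
      ⟨.reset, a + 2, Function.update (tape a w.length u) (a + 1) none, []⟩ := by
    have h3 : tape a w.length u (a + 1) ≠ none := by simp [tape, ha]
    simp [hstep, act, inputRead_succ w a ha, h1, h3, TMove.app]
  have h3 := Reach.family (B := B) (w := w)
    (fun r => ⟨.reset, a + 2 + r, fun p => if p < a + 2 + r then tape (a + 1) w.length [] p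
      else tape a w.length u p, []⟩) (w.length - (a + 1)) fun r hr => by
      simp [hstep, act, inputRead_ne_rend w (a + 2 + r) (by omega), TMove.app]
      refine ⟨by omega, ?_⟩
      funext p
      rcases lt_trichotomy p (a + 2 + r) with hp | hp | hp
      · simp [Function.update_of_ne hp.ne, hp, show p < a + 2 + (r + 1) by omega]
      · subst hp
        simp [tape_two (a := a + 1) (u := []) (n := w.length) (p := a + 2 + r)
          (by simp; omega) (by omega)]
      · simp [Function.update_of_ne hp.ne', show ¬ p < a + 2 + (r + 1) by omega,
          show ¬ p < a + 2 + r by omega]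
  have e1 : Function.update (tape a w.length u) (a + 1) none = fun p =>
      if p < a + 2 + 0 then tape (a + 1) w.length [] p else tape a w.length u p := by
    funext p
    rcases lt_trichotomy p (a + 1) with hp | hp | hp
    · simp [Function.update_of_ne hp.ne, show p < a + 2 by omega, tape_of_le hp.le,
        tape_of_le (show p ≤ a by omega)]
    · subst hp
      simp [tape_of_le (le_refl (a + 1))]
    · simp [Function.update_of_ne hp.ne', show ¬ p < a + 2 by omega]
  have e2 : a + 2 + (w.length - (a + 1)) = w.length + 1 := by omega
  have e3 : (fun p => if p < w.length + 1 then tape (a + 1) w.length [] p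
      else tape a w.length u p) = tape (a + 1) w.length [] := by
    funext p
    split_ifs with hp
    · rfl
    · simp [tape, show w.length < p by omega]
  rw [e2, e3, ← e1, Nat.add_zero] at h3
  have h4 : hstep B w ⟨.reset, w.length + 1, tape (a + 1) w.length [], []⟩ =
      ⟨.rew, w.length, tape (a + 1) w.length [], []⟩ := by
    simp [hstep, act, inputRead_of_length_lt w (w.length + 1) (by omega), TMove.app]
  exact (((((next_reach p u ha.le).trans (.single h2)).trans h3).trans (.single h4)).trans
    (rew_reach _ _)).mono (by omega)

theorem length_word2 (i : ℕ) (x : List Bool) : (word2 i x).length = 3 + i + x.length := by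
  simp [word2, emb]
  omega

theorem ubits_take_reach {i : ℕ} {x : List Bool} (hw : w = word2 i x) (j : ℕ)
    (hj : j ≤ x.length) :
    Reach B w (j * (4 * w.length + 8)) ⟨.copy, 1, tape (3 + i) w.length [], []⟩
      ⟨.copy, 1, tape (3 + i) w.length ((List.range j).map fun l =>
        if word2 i x ++ 2 :: 0 :: ybit' x (l + 1) ∈ B then 1 else 0), []⟩ := by
  have hl : w.length = 3 + i + x.length := by rw [hw, length_word2]
  induction j with
  | zero => exact ⟨0, by simp, rfl⟩
  | succ j ih =>
    have h := bit_reach (B := B) (w := w) (a := 3 + i) (u := (List.range j).map fun l =>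
        if word2 i x ++ 2 :: 0 :: ybit' x (l + 1) ∈ B then 1 else 0)
      (by intro b hb; obtain ⟨l, -, rfl⟩ := List.mem_map.1 hb; split_ifs <;> decide)
      (by omega) (by simp; omega)
    have e : w.length - (3 + i) - (j + 1) = x.length - (j + 1) := by omega
    rw [List.length_map, List.length_range, e] at h
    rw [List.range_succ, List.map_append, add_mul, one_mul]
    refine (ih (by omega)).trans ?_
    subst hw
    exact h

theorem ubits_reach {i : ℕ} {x : List Bool} (hw : w = word2 i x) :
    Reach B w (w.length * (4 * w.length + 8) + (3 * w.length + 6))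
      ⟨.copy, 1, tape (3 + i) w.length [], []⟩
      ⟨.answer (decide (w ++ 2 :: 1 :: ubits' B i x ∈ B)), w.length + 1,
        tape (3 + i) w.length (ubits' B i x), []⟩ := by
  have hl : w.length = 3 + i + x.length := by rw [hw, length_word2]
  refine ((ubits_take_reach hw x.length le_rfl).mono
    (Nat.mul_le_mul_right _ (by omega))).trans ?_
  refine final_reach ?_ (by simp [hl])
  intro b hb
  obtain ⟨l, -, rfl⟩ := List.mem_map.1 hb
  split_ifs <;> decide

theorem word2_getElem?_of_lt {i j : ℕ} (x : List Bool) (h : j < i) :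
    (word2 i x)[3 + j]? = some 1 := by
  rw [add_comm 3 j]
  simp [word2, List.getElem?_append_left, h]

theorem word2_getElem? (i : ℕ) (x : List Bool) :
    (word2 i x)[3 + i]? = x.head?.map bitSym := by
  rw [add_comm 3 i]
  cases x <;> simp [word2, emb, bitSym]

theorem word2_true_cons (i : ℕ) (x : List Bool) : word2 i (true :: x) = word2 (i + 1) x := by
  simp [word2, emb, List.replicate_succ']

theorem emb_injective : Function.Injective emb :=
  List.map_injective_iff.2 fun a b => by cases a <;> cases b <;> simp

theorem word2_injective (i : ℕ) : Function.Injective (word2 i) := fun x y h => by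
  simp only [word2, List.cons.injEq, true_and, List.append_cancel_left_eq] at h
  exact emb_injective h

theorem loop_reject {i : ℕ} {x : List Bool} (hx : x.head? ≠ some true) (hw : w = word2 i x)
    (p : ℕ) (hp : p ≤ w.length) (u : List (Fin 3)) :
    ∃ c : HCfg, Reach B w ((x.length + 1) * (4 * w.length ^ 2 + 16 * w.length + 20))
        ⟨.back, p, tape (3 + i) w.length u, []⟩ c ∧ (c.st = .acc ∨ c.st = .rej) ∧
      (c.st = .acc ↔ ∃ i' x', i < i' ∧ w = word2 i' x' ∧
        w ++ 2 :: 1 :: ubits' B i' x' ∈ B) := by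
  have hl : w.length = 3 + i + x.length := by rw [hw, length_word2]
  have h1 : w[3 + i]? ≠ some 1 := by
    rw [hw, word2_getElem?]
    rcases x with _ | ⟨_ | _, x⟩ <;> simp_all [bitSym]
  obtain ⟨c, hc, hr⟩ := next_reject (B := B) (w := w) p u (by omega) h1
  refine ⟨c, hr.mono (by nlinarith), .inr hc, ?_⟩
  simp only [hc, reduceCtorEq, false_iff]
  rintro ⟨i', x', hi, hw', -⟩
  exact h1 (hw' ▸ word2_getElem?_of_lt x' hi)

/-- The loop over the decompositions `1² 0 1^i x` of the input. -/
theorem loop_reach (i : ℕ) (x : List Bool) (hw : w = word2 i x) (p : ℕ) (hp : p ≤ w.length)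
    (u : List (Fin 3)) :
    ∃ c : HCfg, Reach B w ((x.length + 1) * (4 * w.length ^ 2 + 16 * w.length + 20))
        ⟨.back, p, tape (3 + i) w.length u, []⟩ c ∧ (c.st = .acc ∨ c.st = .rej) ∧
      (c.st = .acc ↔ ∃ i' x', i < i' ∧ w = word2 i' x' ∧
        w ++ 2 :: 1 :: ubits' B i' x' ∈ B) := by
  induction x generalizing i p u with
  | nil => exact loop_reject (by simp) hw p hp u
  | cons b x ih =>
    rcases b with _ | _
    · exact loop_reject (by simp) hw p hp u
    have hs : w[3 + i]? = some 1 := by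
      rw [hw, word2_getElem?]
      rfl
    rw [word2_true_cons] at hw
    have h1 := (next_continue (B := B) p u hs).trans (ubits_reach (B := B) hw)
    by_cases hB : w ++ 2 :: 1 :: ubits' B (i + 1) x ∈ B
    · refine ⟨_, (h1.trans (.single rfl)).mono ?_, ?_⟩
      · simp only [List.length_cons]
        nlinarith
      · simp [hstep, act, hB, inputRead_ne_lend]
        exact ⟨i + 1, by omega, x, hw, hB⟩
    · have h2 : hstep B w ⟨.answer (decide (w ++ 2 :: 1 :: ubits' B (i + 1) x ∈ B)),
          w.length + 1, tape (3 + (i + 1)) w.length (ubits' B (i + 1) x), []⟩ =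
          ⟨.back, w.length, tape (3 + (i + 1)) w.length (ubits' B (i + 1) x), []⟩ := by
        simp [hstep, act, hB, inputRead_ne_lend, TMove.app]
      obtain ⟨c, hr, hc, hc'⟩ := ih (i + 1) hw w.length le_rfl (ubits' B (i + 1) x)
      refine ⟨c, ((h1.trans (.single h2)).trans hr).mono ?_, hc, hc'.trans ?_⟩
      · simp only [List.length_cons]
        nlinarith
      · constructor
        · rintro ⟨i', x', hi, h⟩
          exact ⟨i', x', by omega, h⟩
        · rintro ⟨i', x', hi, hw', h⟩
          rcases (Nat.succ_le_of_lt hi).eq_or_lt with rfl | hi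
          · exact absurd (word2_injective _ (hw'.symm.trans hw) ▸ h) hB
          · exact ⟨i', x', hi, hw', h⟩

/-! ## The start of a run -/

theorem inputRead_succ_eq_sym (p : ℕ) (a : Fin 3) :
    inputRead w (p + 1) = .sym a ↔ w[p]? = some a := by
  rcases Nat.lt_or_ge p w.length with h | h
  · simp [inputRead_succ w p h, h]
  · simp [inputRead_of_length_lt w (p + 1) (by omega), h]

theorem fill_reach (k : ℕ) (hk : 3 + k ≤ w.length) (h : ∀ p < 3 + k, w[p]? ≠ some 2) :
    Reach B w k ⟨.fill, 4, fun _ => none, []⟩ ⟨.fill, 4 + k, tape 3 (3 + k) [], []⟩ := by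
  have h1 := Reach.family (B := B) (w := w)
    (fun r => ⟨.fill, 4 + r, tape 3 (3 + r) [], []⟩) k fun r hr => by
      have h2 : inputRead w (4 + r) ≠ .sym 2 := by
        rw [show 4 + r = (3 + r) + 1 by omega, Ne, inputRead_succ_eq_sym]
        exact h _ (by omega)
      have h3 : Function.update (tape 3 (3 + r) []) (4 + r) (some 2) =
          tape 3 (3 + (r + 1)) [] := by
        funext p
        by_cases hp : p = 4 + r
        · subst hp
          rw [tape_two (by simp; omega) (by omega), Function.update_self]
        · rw [Function.update_of_ne hp]
          simp only [tape]
          congr 1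
          exact propext (by omega)
      simp [hstep, act, inputRead_ne_rend w (4 + r) (by omega), h2, h3, TMove.app]
      omega
  have h0 : tape 3 3 [] = fun _ => none := by
    funext p
    simp [tape]
  simpa [h0] using h1

theorem exists_eq_word2_zero (h0 : w[0]? = some 1) (h1 : w[1]? = some 1) (h2 : w[2]? = some 0)
    (h : ∀ p : ℕ, w[p]? ≠ some 2) : ∃ y, w = word2 0 y := by
  obtain ⟨z, rfl⟩ : ∃ z, w = 1 :: 1 :: 0 :: z := by
    rcases w with _ | ⟨a, _ | ⟨b, _ | ⟨c, z⟩⟩⟩ <;> simp_all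
  refine ⟨z.map fun a => decide (a = 1), ?_⟩
  have hz : z = z.map fun a => if a = 1 then 1 else 0 := by
    refine (List.map_id z).symm.trans (List.map_congr_left fun a ha => ?_)
    obtain ⟨p, hp⟩ := List.mem_iff_getElem?.1 ha
    have ha2 : a ≠ 2 := fun e => h (p + 3) (by simpa [e] using hp)
    revert ha2
    fin_cases a <;> simp
  simpa [word2, emb, Function.comp_def] using hz

theorem word2_getElem?_ne_two (i : ℕ) (x : List Bool) (p : ℕ) : (word2 i x)[p]? ≠ some 2 := by
  intro h
  have h := List.mem_of_getElem? h
  simp [word2, emb] at h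

theorem run_reach :
    ∃ c : HCfg, Reach B w ((w.length + 1) * (4 * w.length ^ 2 + 16 * w.length + 30))
        ⟨.start, 0, fun _ => none, []⟩ c ∧ (c.st = .acc ∨ c.st = .rej) ∧
      (c.st = .acc ↔ w ∈ L2 B) := by
  have reject {d : HCfg} {k : ℕ} (h : Reach B w k ⟨.start, 0, fun _ => none, []⟩ d)
      (hd : (hstep B w d).st = .rej) (hk : k ≤ w.length + 10) (hw : ∀ i x, w ≠ word2 i x) :
      ∃ c : HCfg, Reach B w ((w.length + 1) * (4 * w.length ^ 2 + 16 * w.length + 30))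
        ⟨.start, 0, fun _ => none, []⟩ c ∧ (c.st = .acc ∨ c.st = .rej) ∧
      (c.st = .acc ↔ w ∈ L2 B) := by
    refine ⟨_, (h.trans (.single rfl)).mono (by nlinarith), .inr hd, ?_⟩
    simp only [hd, reduceCtorEq, false_iff]
    rintro ⟨i, -, x, hx, -⟩
    exact hw i x hx
  have s0 : Reach B w 1 ⟨.start, 0, fun _ => none, []⟩ ⟨.pre1, 1, fun _ => none, []⟩ :=
    .single (by simp [hstep, act, TMove.app])
  by_cases h0 : w[0]? = some 1
  swap
  · refine reject s0 ?_ (by omega) fun i x hx => h0 (by simp [hx, word2])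
    have := mt (inputRead_succ_eq_sym 0 1).1 h0
    simp_all [hstep, act]
  have s1 := s0.trans (.single (b := ⟨.pre2, 2, fun _ => none, []⟩) (by
    simp [hstep, act, (inputRead_succ_eq_sym 0 1).2 h0, TMove.app]))
  by_cases h1 : w[1]? = some 1
  swap
  · refine reject s1 ?_ (by omega) fun i x hx => h1 (by simp [hx, word2])
    have := mt (inputRead_succ_eq_sym 1 1).1 h1
    simp_all [hstep, act]
  have s2 := s1.trans (.single (b := ⟨.pre3, 3, fun _ => none, []⟩) (by
    simp [hstep, act, (inputRead_succ_eq_sym 1 1).2 h1, TMove.app]))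
  by_cases h2 : w[2]? = some 0
  swap
  · refine reject s2 ?_ (by omega) fun i x hx => h2 (by simp [hx, word2])
    have := mt (inputRead_succ_eq_sym 2 0).1 h2
    simp_all [hstep, act]
  have s3 := s2.trans (.single (b := ⟨.fill, 4, fun _ => none, []⟩) (by
    simp [hstep, act, (inputRead_succ_eq_sym 2 0).2 h2, TMove.app]))
  have hl : 3 ≤ w.length := (List.getElem?_eq_some_iff.1 h2).1
  by_cases h : ∃ p : ℕ, w[p]? = some 2
  · have hp := Nat.find_spec h
    have hm : ∀ q < Nat.find h, w[q]? ≠ some 2 := fun q hq => Nat.find_min h hq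
    generalize Nat.find h = p at hp hm
    have hpl : p < w.length := (List.getElem?_eq_some_iff.1 hp).1
    have hp3 : 3 ≤ p := by
      by_contra hlt
      interval_cases p <;> simp_all
    obtain ⟨k, rfl⟩ := Nat.exists_eq_add_of_le hp3
    refine reject (s3.trans (fill_reach k (by omega) hm)) ?_ (by omega)
      fun i x hx => word2_getElem?_ne_two i x _ (hx ▸ hp)
    have e : inputRead w (4 + k) = .sym 2 := by
      rw [show 4 + k = 3 + k + 1 by omega, inputRead_succ_eq_sym, hp]
    simp [hstep, act, e]
  · have h := not_exists.1 h
    obtain ⟨y, hy⟩ := exists_eq_word2_zero h0 h1 h2 h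
    have hly : w.length = 3 + y.length := by rw [hy, length_word2]
    have s4 := s3.trans (fill_reach (B := B) y.length hly.ge fun p _ => h p)
    rw [← hly] at s4
    have s5 : hstep B w ⟨.fill, 4 + y.length, tape 3 w.length [], []⟩ =
        ⟨.back, w.length, tape 3 w.length [], []⟩ := by
      simp [hstep, act, inputRead_of_length_lt w (4 + y.length) (by omega), TMove.app]
      omega
    obtain ⟨c, hr, hc, hc'⟩ := loop_reach (B := B) 0 y hy w.length le_rfl []
    refine ⟨c, ((s4.trans (.single s5)).trans hr).mono (by nlinarith), hc, hc'.trans ?_⟩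
    constructor
    · rintro ⟨i, x, hi, hx, hB⟩
      exact ⟨i, hi, x, hx, hx ▸ hB⟩
    · rintro ⟨i, hi, x, hx, hB⟩
      exact ⟨i, x, hi, hx, hx ▸ hB⟩

end Runs

theorem machine_decidesT (B : Set (List (Fin 3))) :
    machine.DecidesT B (L2 B) (polyB (fun w : List (Fin 3) => w.length) 8) := by
  intro w
  obtain ⟨c, ⟨t, ht, rfl⟩, hc, hL⟩ := run_reach (B := B) (w := w)
  obtain ⟨mx, hm⟩ := machine_cfgAt B w t
  have e (s t : St) : stEquiv s = stEquiv t ↔ s = t := stEquiv.injective.eq_iff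
  refine ⟨t, ?_, ?_, ?_⟩
  · have h1 : t ≤ (w.length * w.length + 2) ^ 8 := by
      refine ht.trans ?_
      generalize w.length = n
      have hn : n ≤ n * n := Nat.le_mul_self n
      calc (n + 1) * (4 * n ^ 2 + 16 * n + 30)
          ≤ (n * n + 2) * (2 ^ 6 * (n * n + 2)) := Nat.mul_le_mul (by omega) (by nlinarith)
        _ ≤ (n * n + 2) * ((n * n + 2) ^ 6 * (n * n + 2)) := by gcongr; omega
        _ = (n * n + 2) ^ 8 := by ring
    unfold polyB
    exact_mod_cast h1
  · rw [hm]
    exact hc.imp (e _ _).2 (e _ _).2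
  · rw [hm, ← hL]
    exact (e _ _).symm

/-- For every oracle `B`, `(L₂^B, ||) ∈ para-P^B`. -/
theorem stmt13 (B : Set (List (Fin 3))) :
    (L2 B, fun w : List (Fin 3) => w.length) ∈ paraP (1 : Fin 3) B := by
  exact ⟨logSpaceSizeParam_length, machine, 8, machine_decidesT B⟩
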